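/- The map λ ↦ X(λ), which sends a Young diagram λ to the finite subset X(λ) of ℤ + 1/2 constructed from the Frobenius coordinates of λ⊔λ, is a bijection from the set 𝕐 of all Young diagrams onto the set Conf^L of admissible configurations. -/

import Mathlib

/-- The doubled diagram `λ⊔λ = (λ_1,λ_1,λ_2,λ_2,…)`: row `i` (0-indexed) has length
`λ.rowLen (i/2)`. -/
def YoungDiagram.double (μ : YoungDiagram) : YoungDiagram where
  cells := μ.cells.biUnion fun c => {(2 * c.1, c.2), (2 * c.1 + 1, c.2)}
  isLowerSet := by
    have hmem : ∀ i j : ℕ,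
        ((i, j) ∈ μ.cells.biUnion fun c =>
          ({(2 * c.1, c.2), (2 * c.1 + 1, c.2)} : Finset (ℕ × ℕ))) ↔ (i / 2, j) ∈ μ.cells := by
      intro i j
      simp only [Finset.mem_biUnion, Finset.mem_insert, Finset.mem_singleton, Prod.mk.injEq]
      constructor
      · rintro ⟨c, hc, (⟨h1, h2⟩ | ⟨h1, h2⟩)⟩ <;> subst h2
        · have : i / 2 = c.1 := by omega
          rw [this]; exact hc
        · have : i / 2 = c.1 := by omega
          rw [this]; exact hc
      · intro h
        refine ⟨(i / 2, j), h, ?_⟩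
        rcases Nat.even_or_odd i with ⟨k, hk⟩ | ⟨k, hk⟩
        · left; exact ⟨by omega, rfl⟩
        · right; exact ⟨by omega, rfl⟩
    intro c1 c2 hle h1
    have h1' : (c1.1, c1.2) ∈ μ.cells.biUnion fun c =>
        ({(2 * c.1, c.2), (2 * c.1 + 1, c.2)} : Finset (ℕ × ℕ)) := h1
    rw [hmem] at h1'
    have hle' : ((c2.1 / 2, c2.2) : ℕ × ℕ) ≤ (c1.1 / 2, c1.2) :=
      ⟨Nat.div_le_div_right hle.1, hle.2⟩
    have h2' : ((c2.1 / 2, c2.2) : ℕ × ℕ) ∈ (μ.cells : Set (ℕ × ℕ)) :=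
      μ.isLowerSet hle' h1'
    exact (hmem c2.1 c2.2).mpr h2'

/-- The number `d` of diagonal boxes of a Young diagram. -/
def frobD (μ : YoungDiagram) : ℕ := (μ.cells.filter fun c => c.1 = c.2).card

/-- Frobenius coordinate `P_{i+1} = μ_{i+1} − (i+1)` (0-indexed `i`). -/
def frobP (μ : YoungDiagram) (i : ℕ) : ℕ := μ.rowLen i - (i + 1)

/-- Frobenius coordinate `Q_{i+1} = μ'_{i+1} − (i+1)` (0-indexed `i`). -/
def frobQ (μ : YoungDiagram) (i : ℕ) : ℕ := μ.colLen i - (i + 1)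

/-! We encode the lattice `𝔛 = ℤ + 1/2` by labels: the integer `a` represents the
half-integer point `a + 1/2`. A finite configuration is thus a `Finset ℤ`;
negative half-integers correspond to labels `a < 0`, positive ones to `a ≥ 0`,
and the point `1/2` is the label `0`. -/

/-- `X_- = X ∩ 𝔛_-`, listed in increasing order. -/
def negList (X : Finset ℤ) : List ℤ := (X.filter fun a => a < 0).sort (· ≤ ·)

/-- `(x_1^+ − 1, x_1^+, …, x_m^+ − 1, x_m^+)` built from the points of `X_+` exceeding `1/2`
(i.e. labels `≥ 1`), listed in increasing order. -/
def posBase (X : Finset ℤ) : List ℤ :=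
  ((X.filter fun a => 1 ≤ a).sort (· ≤ ·)).flatMap fun a => [a - 1, a]

/-- The tuple `T̃X_+`: prepend the point `1/2` (label `0`) if it belongs to `X`. -/
def tPos (X : Finset ℤ) : List ℤ := if (0 : ℤ) ∈ X then 0 :: posBase X else posBase X

/-- The entries of `T̃X_+` listed in increasing order `(t_1 < ⋯ < t_d)`. -/
def tPosSorted (X : Finset ℤ) : List ℤ := (tPos X).toFinset.sort (· ≤ ·)

/-- The set `Conf^L` of admissible configurations: (i) all entries of `T̃X_+` are distinct;
(ii) `T̃X_-` (`= X_-`) and `T̃X_+` have the same number of entries; (iii) writing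
`T̃X_- = (x_1^- < ⋯ < x_d^-)`, the integer `−x_i^- − 1/2` is `≡ i (mod 2)` (for the label
`b` of `x_i^-` this integer is `−b − 1`; here `k` is the 0-indexed position, `i = k + 1`). -/
def ConfL : Set (Finset ℤ) :=
  {X | (tPos X).Nodup ∧ (negList X).length = (tPos X).length ∧
    ∀ k : ℕ, k < (negList X).length →
      (-(negList X).getD k 0 - 1) % 2 = ((k : ℤ) + 1) % 2}

/-- The embedding `λ ↦ X(λ)`: with `(P_1,…,P_D | Q_1,…,Q_D)` the Frobenius coordinates of
`λ⊔λ` (0-indexed here), `X_- = {−Q_i − 1/2}` (labels `−Q_i − 1`); `X_+` consists of the points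
`P_j + 1/2` for the 1-indexed odd positions `j = 1, 3, …` with `j ≤ D − 1` (0-indexed: even `k`
with `k + 1 < D`), together with the point `1/2` (label `0`) when `D` is odd. -/
def configOf (lam : YoungDiagram) : Finset ℤ :=
  ((Finset.range (frobD lam.double)).image fun i => -(frobQ lam.double i : ℤ) - 1) ∪
    (((Finset.range (frobD lam.double)).filter fun k => k % 2 = 0 ∧ k + 1 < frobD lam.double).image
      fun k => (frobP lam.double k : ℤ)) ∪
    (if Odd (frobD lam.double) then {0} else ∅)

namespace YoungDiagram

theorem mem_double {lam : YoungDiagram} {i j : ℕ} : (i, j) ∈ lam.double ↔ (i / 2, j) ∈ lam := by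
  rw [← mem_cells, ← mem_cells]
  simp only [double, Finset.mem_biUnion, Finset.mem_insert, Finset.mem_singleton, Prod.mk.injEq,
    Prod.exists]
  constructor
  · rintro ⟨a, b, hc, ⟨h1, rfl⟩ | ⟨h1, rfl⟩⟩
    · rwa [show i / 2 = a by omega]
    · rwa [show i / 2 = a by omega]
  · intro h
    exact ⟨i / 2, j, h, by omega⟩

theorem rowLen_double (lam : YoungDiagram) (i : ℕ) : lam.double.rowLen i = lam.rowLen (i / 2) :=
  eq_of_forall_lt_iff fun j => by rw [← mem_iff_lt_rowLen, ← mem_iff_lt_rowLen, mem_double]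

theorem colLen_double (lam : YoungDiagram) (j : ℕ) : lam.double.colLen j = 2 * lam.colLen j :=
  eq_of_forall_lt_iff fun i => by
    rw [← mem_iff_lt_colLen, mem_double, mem_iff_lt_colLen]
    omega

theorem lt_frobD_iff {μ : YoungDiagram} {i : ℕ} : i < frobD μ ↔ (i, i) ∈ μ := by
  have hex : ∃ n, ∀ i, i < n ↔ (i, i) ∈ μ := by
    have hfin : ∃ n, (n, n) ∉ μ := by
      by_contra! h
      have := mem_iff_lt_rowLen.1 (μ.up_left_mem (Nat.zero_le _) le_rfl (h (μ.rowLen 0)))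
      omega
    classical
    refine ⟨Nat.find hfin, fun i => ⟨fun h => not_not.1 (Nat.find_min hfin h), fun h => ?_⟩⟩
    by_contra! hle
    exact Nat.find_spec hfin (μ.up_left_mem hle hle h)
  obtain ⟨n, hn⟩ := hex
  suffices frobD μ = n by rw [this, hn]
  have : (μ.cells.filter fun c => c.1 = c.2) = (Finset.range n).image fun i => (i, i) := by
    ext ⟨a, b⟩
    simp only [Finset.mem_filter, mem_cells, Finset.mem_image, Finset.mem_range, Prod.mk.injEq]
    constructor
    · rintro ⟨h, rfl⟩
      exact ⟨a, (hn a).2 h, rfl, rfl⟩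
    · rintro ⟨i, h, rfl, rfl⟩
      exact ⟨(hn i).1 h, rfl⟩
  rw [frobD, this, Finset.card_image_of_injective, Finset.card_range]
  intro a b h
  exact (Prod.mk.inj h).1

theorem frobD_le_rowLen {μ : YoungDiagram} {i : ℕ} (h : i < frobD μ) : frobD μ ≤ μ.rowLen i := by
  have : (i, frobD μ - 1) ∈ μ :=
    μ.up_left_mem (by omega) le_rfl (lt_frobD_iff.1 (show frobD μ - 1 < frobD μ by omega))
  rw [mem_iff_lt_rowLen] at this
  omega

theorem frobD_le_colLen {μ : YoungDiagram} {i : ℕ} (h : i < frobD μ) : frobD μ ≤ μ.colLen i := by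
  have : (frobD μ - 1, i) ∈ μ :=
    μ.up_left_mem le_rfl (by omega) (lt_frobD_iff.1 (show frobD μ - 1 < frobD μ by omega))
  rw [mem_iff_lt_colLen] at this
  omega

theorem rowLen_le_frobD {μ : YoungDiagram} {i : ℕ} (h : frobD μ ≤ i) : μ.rowLen i ≤ frobD μ := by
  by_contra! hlt
  have : (frobD μ, frobD μ) ∈ μ := μ.up_left_mem h le_rfl (mem_iff_lt_rowLen.2 hlt)
  exact lt_irrefl _ (lt_frobD_iff.2 this)

/-- The Frobenius coordinates of `λ⊔λ` determine `λ`. -/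
theorem mem_iff_frobenius_double (lam : YoungDiagram) (k j : ℕ) :
    (k, j) ∈ lam ↔
      if 2 * k < frobD lam.double then
        j < if 2 * k + 1 < frobD lam.double then frobP lam.double (2 * k) + 2 * k + 1
          else frobD lam.double
      else j < frobD lam.double ∧ 2 * k < frobQ lam.double j + j + 1 := by
  have hmem : (k, j) ∈ lam ↔ (2 * k, j) ∈ lam.double := by
    rw [mem_double, show 2 * k / 2 = k by omega]
  rw [hmem]
  split_ifs with h1 h2
  · have := frobD_le_rowLen h1
    rw [mem_iff_lt_rowLen, frobP]
    omega
  · have h3 := frobD_le_rowLen h1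
    have h4 : lam.double.rowLen (2 * k + 1) ≤ _ := rowLen_le_frobD (by omega)
    rw [rowLen_double, show (2 * k + 1) / 2 = 2 * k / 2 by omega, ← rowLen_double] at h4
    rw [mem_iff_lt_rowLen]
    omega
  · have hj : (2 * k, j) ∈ lam.double → j < frobD lam.double := fun h =>
      (mem_iff_lt_rowLen.1 h).trans_le (rowLen_le_frobD (by omega))
    rw [← and_iff_right_of_imp hj]
    refine and_congr_right fun hlt => ?_
    have := frobD_le_colLen hlt
    rw [mem_iff_lt_colLen, frobQ]
    omega

end YoungDiagram

open YoungDiagram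

/-- The conditions satisfied by the number `d` of diagonal boxes and the Frobenius coordinates
`(P_1, P_3, … | Q_1, Q_2, …)` of a doubled diagram, with `p k = P_{2k+1}` and `q k = Q_{k+1}`. -/
structure IsDoubleCoord (d : ℕ) (q p : ℕ → ℕ) : Prop where
  q_anti : ∀ k, k + 1 < d → q (k + 1) < q k
  q_parity : ∀ k, k < d → q k % 2 = (k + 1) % 2
  p_gap : ∀ k, 2 * k + 3 < d → p (k + 1) + 2 ≤ p k
  p_pos : ∀ k, 2 * k + 1 < d → 1 + d % 2 ≤ p k

/-- The configuration attached to the Frobenius coordinates of a doubled diagram. -/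
def coordConfig (d : ℕ) (q p : ℕ → ℕ) : Finset ℤ :=
  ((Finset.range d).image fun i => -(q i : ℤ) - 1) ∪
    ((Finset.range (d / 2)).image fun k => (p k : ℤ)) ∪ (if Odd d then {0} else ∅)

theorem mem_coordConfig {d : ℕ} {q p : ℕ → ℕ} {a : ℤ} :
    a ∈ coordConfig d q p ↔ (∃ i < d, -(q i : ℤ) - 1 = a) ∨ (∃ k < d / 2, (p k : ℤ) = a) ∨
      (d % 2 = 1 ∧ a = 0) := by
  rw [coordConfig]
  split_ifs with h <;> rw [Nat.odd_iff] at h <;> simp [h]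
  rw [or_comm, or_assoc]

theorem configOf_eq_coordConfig (lam : YoungDiagram) :
    configOf lam = coordConfig (frobD lam.double) (frobQ lam.double)
      fun k => frobP lam.double (2 * k) := by
  rw [configOf, coordConfig]
  congr 2
  ext a
  simp only [Finset.mem_image, Finset.mem_filter, Finset.mem_range]
  constructor
  · rintro ⟨k, ⟨h1, h2, h3⟩, rfl⟩
    exact ⟨k / 2, by omega, by rw [show 2 * (k / 2) = k by omega]⟩
  · rintro ⟨k, h, rfl⟩
    exact ⟨2 * k, by omega, rfl⟩

theorem isDoubleCoord_frobenius_double (lam : YoungDiagram) :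
    IsDoubleCoord (frobD lam.double) (frobQ lam.double) fun k => frobP lam.double (2 * k) where
  q_anti k hk := by
    have h1 := frobD_le_colLen hk
    have h2 := lam.double.colLen_anti k (k + 1) (by omega)
    simp only [frobQ]
    omega
  q_parity k hk := by
    have h1 := frobD_le_colLen hk
    have h2 := colLen_double lam k
    simp only [frobQ]
    omega
  p_gap k hk := by
    have h1 := frobD_le_rowLen (μ := lam.double) (i := 2 * (k + 1)) (by omega)
    have h2 := lam.double.rowLen_anti (2 * k) (2 * (k + 1)) (by omega)
    simp only [frobP]
    omega
  p_pos k hk := by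
    have h1 := frobD_le_rowLen (μ := lam.double) (i := 2 * k) (by omega)
    simp only [frobP]
    omega

namespace IsDoubleCoord

variable {d : ℕ} {q p : ℕ → ℕ}

theorem q_add_le (h : IsDoubleCoord d q p) {i j : ℕ} (hij : i ≤ j) :
    j < d → q j + j ≤ q i + i := by
  induction j, hij using Nat.le_induction with
  | base => exact fun _ => le_rfl
  | succ j hj ih =>
    intro hd
    have := h.q_anti j hd
    have := ih (by omega)
    omega

theorem p_add_le (h : IsDoubleCoord d q p) {i j : ℕ} (hij : i ≤ j) :
    2 * j + 1 < d → p j + 2 * j ≤ p i + 2 * i := by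
  induction j, hij using Nat.le_induction with
  | base => exact fun _ => le_rfl
  | succ j hj ih =>
    intro hd
    have := h.p_gap j (by omega)
    have := ih (by omega)
    omega

theorem le_q_add (h : IsDoubleCoord d q p) {i : ℕ} (hi : i < d) : d ≤ q i + i + 1 := by
  have := h.q_add_le (show i ≤ d - 1 by omega) (by omega)
  omega

theorem le_p_add (h : IsDoubleCoord d q p) {k : ℕ} (hk : 2 * k + 1 < d) :
    d ≤ p k + 2 * k + 1 := by
  have h1 := h.p_add_le (show k ≤ d / 2 - 1 by omega) (by omega)
  have h2 := h.p_pos (d / 2 - 1) (by omega)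
  omega

theorem exists_youngDiagram (h : IsDoubleCoord d q p) :
    ∃ lam : YoungDiagram, ∀ k j, (k, j) ∈ lam ↔
      if 2 * k < d then j < if 2 * k + 1 < d then p k + 2 * k + 1 else d
      else j < d ∧ 2 * k < q j + j + 1 := by
  set N := d + p 0 + q 0 + 2 with hN
  refine ⟨⟨((Finset.range N) ×ˢ (Finset.range N)).filter fun c =>
      if 2 * c.1 < d then c.2 < if 2 * c.1 + 1 < d then p c.1 + 2 * c.1 + 1 else d
      else c.2 < d ∧ 2 * c.1 < q c.2 + c.2 + 1, ?_⟩, fun k j => ?_⟩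
  · rintro ⟨k, j⟩ ⟨k', j'⟩ ⟨hk : k' ≤ k, hj : j' ≤ j⟩
    simp only [Finset.coe_filter, Finset.mem_product, Finset.mem_range, Set.mem_ofPred_eq]
    rintro ⟨⟨h1, h2⟩, h3⟩
    refine ⟨⟨by omega, by omega⟩, ?_⟩
    by_cases hkd : 2 * k + 1 < d
    · have := h.p_add_le hk hkd
      rw [if_pos (by omega), if_pos hkd] at h3
      rw [if_pos (by omega), if_pos (by omega)]
      omega
    · have hjd : j < d := by
        split_ifs at h3 <;> omega
      by_cases hk1 : 2 * k' + 1 < d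
      · have := h.le_p_add hk1
        rw [if_pos (by omega), if_pos (by omega)]
        omega
      · by_cases hk2 : 2 * k' < d
        · rw [if_pos hk2, if_neg hk1]
          omega
        · have := h.q_add_le hj hjd
          rw [if_neg (by omega)] at h3
          rw [if_neg hk2]
          omega
  · rw [← mem_cells]
    simp only [Finset.mem_filter, Finset.mem_product, Finset.mem_range, and_iff_right_iff_imp]
    intro h3
    by_cases hkd : 2 * k + 1 < d
    · have := h.p_add_le (Nat.zero_le k) hkd
      rw [if_pos (by omega), if_pos hkd] at h3
      omega
    · by_cases hk2 : 2 * k < d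
      · rw [if_pos hk2, if_neg hkd] at h3
        omega
      · rw [if_neg hk2] at h3
        have := h.q_add_le (Nat.zero_le j) h3.1
        omega

/-- Admissible coordinates are the Frobenius coordinates of some doubled diagram. -/
theorem exists_configOf_eq (h : IsDoubleCoord d q p) :
    ∃ lam : YoungDiagram, configOf lam = coordConfig d q p := by
  obtain ⟨lam, hlam⟩ := h.exists_youngDiagram
  have hD : frobD lam.double = d := eq_of_forall_lt_iff fun i => by
    rw [lt_frobD_iff, mem_double, hlam]
    by_cases h1 : 2 * (i / 2) + 1 < d
    · have := h.le_p_add h1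
      have := h.p_pos _ h1
      rw [if_pos (by omega), if_pos h1]
      omega
    · split_ifs <;> omega
  have hQ : ∀ j < d, frobQ lam.double j = q j := fun j hj => by
    have h1 := h.le_q_add hj
    have h2 := h.q_parity j hj
    have : lam.colLen j = (q j + j + 1) / 2 := eq_of_forall_lt_iff fun k => by
      rw [← mem_iff_lt_colLen, hlam]
      by_cases hk : 2 * k + 1 < d
      · have := h.le_p_add hk
        rw [if_pos (by omega), if_pos hk]
        omega
      · split_ifs <;> omega
    rw [frobQ, colLen_double, this]
    omega
  have hP : ∀ k < d / 2, frobP lam.double (2 * k) = p k := fun k hk => by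
    have : lam.rowLen k = p k + 2 * k + 1 := eq_of_forall_lt_iff fun j => by
      rw [← mem_iff_lt_rowLen, hlam, if_pos (by omega), if_pos (by omega)]
    rw [frobP, rowLen_double, show 2 * k / 2 = k by omega, this]
    omega
  refine ⟨lam, ?_⟩
  rw [configOf_eq_coordConfig, hD]
  ext a
  simp only [mem_coordConfig]
  refine or_congr ?_ (or_congr ?_ Iff.rfl)
  · exact exists_congr fun i => and_congr_right fun hi => by rw [hQ i hi]
  · exact exists_congr fun i => and_congr_right fun hi => by rw [hP i hi]

theorem negList_coordConfig (h : IsDoubleCoord d q p) :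
    negList (coordConfig d q p) = (List.range d).map fun i => -(q i : ℤ) - 1 := by
  have hs : ((List.range d).map fun i => -(q i : ℤ) - 1).Pairwise (· < ·) := by
    rw [List.pairwise_map]
    refine List.pairwise_lt_range.imp_of_mem fun {a b} _ hb hab => ?_
    have := h.q_add_le hab.le (List.mem_range.1 hb)
    omega
  rw [negList]
  have : (coordConfig d q p).filter (fun a => a < 0) =
      ((List.range d).map fun i => -(q i : ℤ) - 1).toFinset := by
    ext a
    simp only [Finset.mem_filter, mem_coordConfig, List.mem_toFinset, List.mem_map, List.mem_range]
    constructor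
    · rintro ⟨h1 | ⟨k, _, h1⟩ | h1, h2⟩
      · exact h1
      · omega
      · omega
    · rintro ⟨i, hi, rfl⟩
      exact ⟨Or.inl ⟨i, hi, rfl⟩, by omega⟩
  rw [this]
  exact (List.toFinset_sort _ (hs.imp ne_of_lt)).2 (hs.imp le_of_lt)

theorem sort_pos_coordConfig (h : IsDoubleCoord d q p) :
    ((coordConfig d q p).filter fun a => 1 ≤ a).sort (· ≥ ·) =
      (List.range (d / 2)).map fun k => (p k : ℤ) := by
  have hs : ((List.range (d / 2)).map fun k => (p k : ℤ)).Pairwise (· > ·) := by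
    rw [List.pairwise_map]
    refine List.pairwise_lt_range.imp_of_mem fun {a b} _ hb hab => ?_
    rw [List.mem_range] at hb
    have := h.p_add_le hab.le (by omega)
    omega
  have : (coordConfig d q p).filter (fun a => 1 ≤ a) =
      ((List.range (d / 2)).map fun k => (p k : ℤ)).toFinset := by
    ext a
    simp only [Finset.mem_filter, mem_coordConfig, List.mem_toFinset, List.mem_map, List.mem_range]
    constructor
    · rintro ⟨⟨k, _, h1⟩ | h1 | h1, h2⟩
      · omega
      · exact h1
      · omega
    · rintro ⟨i, hi, rfl⟩
      have := h.p_pos i (by omega)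
      exact ⟨Or.inr (Or.inl ⟨i, hi, rfl⟩), by omega⟩
  rw [this]
  exact (List.toFinset_sort _ (hs.imp ne_of_gt)).2 (hs.imp le_of_lt)

end IsDoubleCoord

theorem nodup_tPos_iff {X : Finset ℤ} : (tPos X).Nodup ↔ ∀ a ∈ X, 0 ≤ a → a + 1 ∉ X := by
  have hbase : (posBase X).Nodup ↔ ∀ a ∈ X, 1 ≤ a → a + 1 ∉ X := by
    rw [posBase, List.nodup_flatMap]
    constructor
    · rintro ⟨-, h⟩ a ha h1 h2
      have hsymm : Std.Symm (Function.onFun List.Disjoint fun a : ℤ => [a - 1, a]) :=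
        ⟨fun _ _ h => List.Disjoint.symm h⟩
      have := h.forall (a := a) (b := a + 1) (by simp [ha, h1]) (by simp [h2]; omega) (by omega)
      simp [Function.onFun] at this
    · intro h
      refine ⟨fun x _ => by simp, ?_⟩
      refine ((Finset.sort_nodup _ _)).imp_of_mem fun {a b} ha hb hab => ?_
      simp only [Finset.mem_sort, Finset.mem_filter] at ha hb
      have h1 := h a ha.1 ha.2
      have h2 := h b hb.1 hb.2
      have h3 : a ≠ b + 1 := fun e => h2 (e ▸ ha.1)
      have h4 : b ≠ a + 1 := fun e => h1 (e ▸ hb.1)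
      simp [Function.onFun]
      omega
  rw [tPos]
  split_ifs with h0
  · have hmem : 0 ∈ posBase X ↔ 1 ∈ X := by
      simp only [posBase, List.mem_flatMap, Finset.mem_sort, Finset.mem_filter, List.mem_cons,
        List.not_mem_nil, or_false]
      constructor
      · rintro ⟨a, ⟨h1, h2⟩, h3⟩
        rwa [show (1 : ℤ) = a by omega]
      · intro h
        exact ⟨1, ⟨h, le_rfl⟩, by omega⟩
    rw [List.nodup_cons, hbase, hmem]
    constructor
    · rintro ⟨h1, h2⟩ a ha ha0
      rcases ha0.eq_or_lt with rfl | h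
      · simpa using h1
      · exact h2 a ha h
    · intro h
      exact ⟨by simpa using h 0 h0 le_rfl, fun a ha h1 => h a ha (by omega)⟩
  · rw [hbase]
    refine forall₂_congr fun a ha => ?_
    have : a ≠ 0 := fun e => h0 (e ▸ ha)
    rw [show 0 ≤ a ↔ 1 ≤ a by omega]

theorem length_tPos (X : Finset ℤ) :
    (tPos X).length = 2 * (X.filter fun a => 1 ≤ a).card + if 0 ∈ X then 1 else 0 := by
  have : (posBase X).length = 2 * (X.filter fun a => 1 ≤ a).card := by
    simp [posBase, List.length_flatMap, mul_comm]
  rw [tPos]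
  split_ifs <;> simp [this]

theorem IsDoubleCoord.coordConfig_mem_confL {d : ℕ} {q p : ℕ → ℕ} (h : IsDoubleCoord d q p) :
    coordConfig d q p ∈ ConfL := by
  have h0 : 0 ∈ coordConfig d q p ↔ d % 2 = 1 := by
    rw [mem_coordConfig]
    constructor
    · rintro (⟨i, _, h1⟩ | ⟨k, hk, h1⟩ | h1)
      · omega
      · have := h.p_pos k (by omega)
        omega
      · exact h1.1
    · exact fun h => Or.inr (Or.inr ⟨h, rfl⟩)
  refine ⟨nodup_tPos_iff.2 ?_, ?_, ?_⟩
  · intro a ha h0 hb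
    rw [mem_coordConfig] at ha hb
    obtain ⟨l, hl, hlb⟩ : ∃ k < d / 2, (p k : ℤ) = a + 1 := by
      rcases hb with ⟨i, _, h1⟩ | h1 | h1
      · omega
      · exact h1
      · omega
    have hl1 := h.p_pos l (by omega)
    rcases ha with ⟨i, _, h1⟩ | ⟨k, hk, h1⟩ | h1
    · omega
    · rcases lt_trichotomy k l with hkl | rfl | hkl
      · have := h.p_add_le hkl.le (by omega)
        omega
      · omega
      · have := h.p_add_le hkl.le (by omega)
        omega
    · omega
  · rw [length_tPos, h.negList_coordConfig, ← Finset.length_sort (· ≥ ·), h.sort_pos_coordConfig]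
    simp only [h0, List.length_map, List.length_range]
    split_ifs <;> omega
  · intro k hk
    rw [h.negList_coordConfig] at hk ⊢
    rw [List.getD_eq_getElem _ _ hk]
    simp only [List.length_map, List.length_range] at hk
    have := h.q_parity k hk
    simp only [List.getElem_map, List.getElem_range]
    omega

theorem exists_isDoubleCoord_of_mem_confL {X : Finset ℤ} (hX : X ∈ ConfL) :
    ∃ d q p, IsDoubleCoord d q p ∧ X = coordConfig d q p := by
  obtain ⟨h1, h2, h3⟩ := hX
  rw [nodup_tPos_iff] at h1
  rw [length_tPos] at h2
  set L := negList X with hL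
  set M := (X.filter fun a => 1 ≤ a).sort (· ≥ ·) with hM
  have hLs : L.Pairwise (· < ·) := (X.filter fun a => a < 0).sortedLT_sort.pairwise
  have hMs : M.Pairwise (· > ·) := (X.filter fun a => 1 ≤ a).sortedGT_sort.pairwise
  have hLm : ∀ a, a ∈ L ↔ a ∈ X ∧ a < 0 := by simp [hL, negList]
  have hMm : ∀ a, a ∈ M ↔ a ∈ X ∧ 1 ≤ a := by simp [hM]
  rw [← Finset.length_sort (· ≥ ·), ← hM] at h2
  have hpar : 0 ∈ X ↔ L.length % 2 = 1 := by
    split_ifs at h2 with h <;> simp only [h, true_iff, false_iff] <;> omega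
  have hlen : L.length / 2 = M.length := by
    split_ifs at h2 <;> omega
  have hq : ∀ k (hk : k < L.length), ((-L.getD k 0 - 1).toNat : ℤ) = -L[k] - 1 := fun k hk => by
    have := ((hLm _).1 (List.getElem_mem hk)).2
    rw [List.getD_eq_getElem _ _ hk]
    omega
  have hp : ∀ k (hk : k < M.length), ((M.getD k 0).toNat : ℤ) = M[k] := fun k hk => by
    have := ((hMm _).1 (List.getElem_mem hk)).2
    rw [List.getD_eq_getElem _ _ hk]
    omega
  refine ⟨L.length, fun k => (-L.getD k 0 - 1).toNat, fun k => (M.getD k 0).toNat,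
    ⟨fun k hk => ?_, fun k hk => ?_, fun k hk => ?_, fun k hk => ?_⟩, ?_⟩
  · have := List.pairwise_iff_getElem.1 hLs k (k + 1) (by omega) hk (by omega)
    have := hq k (by omega)
    have := hq (k + 1) hk
    omega
  · have h4 := h3 k hk
    have h5 := hq k hk
    rw [List.getD_eq_getElem _ _ hk] at h4
    omega
  · have hk' : k + 1 < M.length := by omega
    have h4 := List.pairwise_iff_getElem.1 hMs k (k + 1) (by omega) hk' (by omega)
    have h5 := hp k (by omega)
    have h6 := hp (k + 1) hk'
    have h7 := (hMm _).1 (List.getElem_mem hk')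
    have h8 := (hMm _).1 (List.getElem_mem (show k < M.length by omega))
    have h9 := h1 _ h7.1 (by omega)
    have : M[k] ≠ M[k + 1] + 1 := fun e => h9 (e ▸ h8.1)
    omega
  · have hk' : k < M.length := by omega
    have h5 := hp k hk'
    have h8 := (hMm _).1 (List.getElem_mem hk')
    by_cases hd : 0 ∈ X
    · have h9 := h1 0 hd le_rfl
      have : M[k] ≠ 0 + 1 := fun e => h9 (e ▸ h8.1)
      omega
    · have := mt hpar.2 hd
      omega
  · ext a
    rw [mem_coordConfig]
    constructor
    · intro ha
      rcases lt_trichotomy a 0 with h | rfl | h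
      · obtain ⟨i, hi, rfl⟩ := List.mem_iff_getElem.1 ((hLm a).2 ⟨ha, h⟩)
        exact Or.inl ⟨i, hi, by have := hq i hi; omega⟩
      · exact Or.inr (Or.inr ⟨hpar.1 ha, rfl⟩)
      · obtain ⟨i, hi, rfl⟩ := List.mem_iff_getElem.1 ((hMm a).2 ⟨ha, h⟩)
        exact Or.inr (Or.inl ⟨i, by omega, hp i hi⟩)
    · rintro (⟨i, hi, rfl⟩ | ⟨k, hk, rfl⟩ | ⟨h, rfl⟩)
      · rw [hq i hi, show -(-L[i] - 1) - 1 = L[i] by ring]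
        exact ((hLm _).1 (List.getElem_mem hi)).1
      · rw [hp k (by omega)]
        exact ((hMm _).1 (List.getElem_mem _)).1
      · exact hpar.2 h

theorem configOf_injective : Function.Injective configOf := by
  intro lam nu heq
  have h1 := isDoubleCoord_frobenius_double lam
  have h2 := isDoubleCoord_frobenius_double nu
  rw [configOf_eq_coordConfig, configOf_eq_coordConfig] at heq
  have hneg := congrArg negList heq
  have hpos := congrArg (fun X : Finset ℤ => (X.filter fun a => 1 ≤ a).sort (· ≥ ·)) heq
  simp only [h1.sort_pos_coordConfig, h2.sort_pos_coordConfig] at hpos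
  rw [h1.negList_coordConfig, h2.negList_coordConfig] at hneg
  have hd : frobD lam.double = frobD nu.double := by simpa using congrArg List.length hneg
  rw [hd, List.map_inj_left] at hneg hpos
  simp only [List.mem_range] at hneg hpos
  ext ⟨k, j⟩
  rw [mem_cells, mem_cells, mem_iff_frobenius_double, mem_iff_frobenius_double, hd]
  split_ifs with hk1 hk2
  · have := hpos k (by omega)
    omega
  · rfl
  · refine and_congr_right fun hj => ?_
    have := hneg j hj
    omega

/-- The map `λ ↦ X(λ)` is a bijection from the set `𝕐` of all Young diagrams onto the set
`Conf^L` of admissible configurations. -/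
theorem configOf_bijOn : Set.BijOn configOf Set.univ ConfL := by
  refine ⟨fun lam _ => ?_, configOf_injective.injOn, fun X hX => ?_⟩
  · rw [configOf_eq_coordConfig]
    exact (isDoubleCoord_frobenius_double lam).coordConfig_mem_confL
  · obtain ⟨d, q, p, h, rfl⟩ := exists_isDoubleCoord_of_mem_confL hX
    obtain ⟨lam, hlam⟩ := h.exists_configOf_eq
    exact ⟨lam, Set.mem_univ _, hlam⟩
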